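/- Let Π be a finite set of at least two process identifiers and let T_exc be the exchanger task on Π. There is no single-operation sequential object L (i.e., no prefix-closed set L of sequential executions of one operation taking a process identifier as input and returning either an identifier or ⊥) such that the set of well-formed executions linearizable with respect to L equals VE(T_exc), the set of well-formed executions satisfying the exchanger task. -/

import Mathlib

/-- An event of an execution: an invocation `inv id x` of the (single) operation by
process `id` with input `x`, or a response `res id y` to process `id` with output `y`.
An execution is a finite sequence (a list) of events. -/
inductive Event (ι V W : Type) : Type
  | inv (id : ι) (x : V)
  | res (id : ι) (y : W)
deriving DecidableEq

variable {ι V W : Type}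

/-- The list of (identifier, input) pairs of the invocations of an execution. -/
def invList (E : List (Event ι V W)) : List (ι × V) :=
  E.filterMap fun e =>
    match e with
    | .inv id x => some (id, x)
    | .res _ _ => none

/-- The list of (identifier, output) pairs of the responses of an execution. -/
def resList (E : List (Event ι V W)) : List (ι × W) :=
  E.filterMap fun e =>
    match e with
    | .inv _ _ => none
    | .res id y => some (id, y)

/-- Number of invocations by process `id` in an execution. -/
def invCount [DecidableEq ι] (id : ι) (E : List (Event ι V W)) : ℕ :=
  (invList E).countP fun p => decide (p.1 = id)

/-- Number of responses to process `id` in an execution. -/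
def resCount [DecidableEq ι] (id : ι) (E : List (Event ι V W)) : ℕ :=
  (resList E).countP fun p => decide (p.1 = id)

/-- An execution is well-formed if each identifier invokes at most once and responds
at most once, the response coming after the invocation (in every prefix, the number of
responses of `id` is at most its number of invocations). -/
def WellFormed [DecidableEq ι] (E : List (Event ι V W)) : Prop :=
  ∀ id : ι, invCount id E ≤ 1 ∧ resCount id E ≤ 1 ∧
    ∀ n : ℕ, resCount id (E.take n) ≤ invCount id (E.take n)

/-- An execution `E` satisfies the exchanger task on the identifier set `Procs` if for
every prefix `E'`: `σ_{E'}` is an input simplex (every invocation is by a process of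
`Procs` with its own identifier as input), every response was preceded by an
invocation, and the outputs produced so far form the restriction of a matching `g` of
the participants satisfying the exchanger predicate: whenever a participant `i` is
matched to `j` (`g i = some j`, where `none` plays the role of `⊥`), then `j` is a
participant, `j ≠ i`, and `g j = some i`. -/
def SatExc [DecidableEq ι] (Procs : Finset ι) (E : List (Event ι ι (Option ι))) : Prop :=
  ∀ n : ℕ,
    (∀ id x, Event.inv id x ∈ E.take n → id ∈ Procs ∧ x = id) ∧
    (∀ id y, Event.res id y ∈ E.take n → ∃ x, Event.inv id x ∈ E.take n) ∧
    ∃ g : ι → Option ι,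
      (∀ i : ι, (∃ x, Event.inv i x ∈ E.take n) → ∀ j : ι, g i = some j →
        (∃ x, Event.inv j x ∈ E.take n) ∧ j ≠ i ∧ g j = some i) ∧
      (∀ id y, Event.res id y ∈ E.take n → g id = y)

/-- Linearizability of a well-formed execution `E` with respect to a single-operation
sequential object, given as a set `L` of sequential executions, i.e. lists of completed
operations `(id, input, output)`.  Some `S ∈ L` contains exactly one completed
operation for each completed operation of `E` (same identifier, input and output),
plus possibly completed operations with matching identifier and input for some pending
invocations of `E`; and whenever one operation's response precedes another's
invocation in `E`, the first precedes the second in `S`. -/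
def Linearizable [DecidableEq ι] (L : Set (List (ι × V × W)))
    (E : List (Event ι V W)) : Prop :=
  ∃ S ∈ L,
    (S.map Prod.fst).Nodup ∧
    (∀ id x y, Event.inv id x ∈ E → Event.res id y ∈ E → (id, x, y) ∈ S) ∧
    (∀ op ∈ S, Event.inv op.1 op.2.1 ∈ E) ∧
    (∀ op ∈ S, ∀ y, Event.res op.1 y ∈ E → op.2.2 = y) ∧
    (∀ (p q : ℕ) (id₁ id₂ : ι) (y : W) (x : V), p < q →
      E[p]? = some (Event.res id₁ y) → E[q]? = some (Event.inv id₂ x) →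
      ∀ (i j : ℕ) (op₁ op₂ : ι × V × W), S[i]? = some op₁ → S[j]? = some op₂ →
        op₁.1 = id₁ → op₂.1 = id₂ → i < j)

theorem wellFormed_solo [DecidableEq ι] (a : ι) (x : V) (y : W) :
    WellFormed [Event.inv a x, Event.res a y] := by
  intro id
  refine ⟨?_, ?_, fun n => ?_⟩
  · by_cases h : a = id <;> simp [invCount, invList, h]
  · by_cases h : a = id <;> simp [resCount, resList, h]
  · rcases n with _ | _ | n <;> by_cases h : a = id <;>
      simp [invCount, invList, resCount, resList, h]

theorem wellFormed_pair [DecidableEq ι] {a b : ι} (hab : a ≠ b) (x x' : V) (y y' : W) :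
    WellFormed [Event.inv a x, Event.inv b x', Event.res a y, Event.res b y'] := by
  intro id
  refine ⟨?_, ?_, fun n => ?_⟩
  · by_cases h : a = id <;> by_cases h' : b = id <;> simp_all [invCount, invList]
  · by_cases h : a = id <;> by_cases h' : b = id <;> simp_all [resCount, resList]
  · rcases n with _ | _ | _ | _ | n <;> by_cases h : a = id <;> by_cases h' : b = id <;>
      simp_all [invCount, invList, resCount, resList]

/-- A successful exchange between two concurrent processes satisfies the exchanger task. -/
theorem satExc_pair [DecidableEq ι] {Procs : Finset ι} {a b : ι} (ha : a ∈ Procs)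
    (hb : b ∈ Procs) (hab : a ≠ b) :
    SatExc Procs [Event.inv a a, Event.inv b b, Event.res a (some b), Event.res b (some a)] := by
  intro n
  rcases n with _ | _ | n
  · exact ⟨by simp, by simp, fun _ => none, by simp, by simp⟩
  · exact ⟨by simp_all, by simp, fun _ => none, by simp, by simp⟩
  · refine ⟨?_, ?_, fun i => if i = a then some b else if i = b then some a else none, ?_, ?_⟩
    · rcases n with _ | _ | n <;> simp <;> grind
    · rcases n with _ | _ | n <;> simp
      all_goals aesop
    · rcases n with _ | _ | n <;> simp <;> grind
    · rcases n with _ | _ | n <;> simp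
      grind

/-- A process running alone cannot have exchanged with another one. -/
theorem not_satExc_solo [DecidableEq ι] {Procs : Finset ι} {a b : ι} (hab : a ≠ b) :
    ¬ SatExc Procs [Event.inv a a, Event.res a (some b)] := by
  intro h
  obtain ⟨-, -, g, hg, hr⟩ := h 2
  obtain ⟨⟨x, hx⟩, -⟩ := hg a ⟨a, by simp⟩ b (hr a (some b) (by simp))
  simp at hx
  exact hab hx.1.symm

theorem linearizable_solo [DecidableEq ι] {L : Set (List (ι × V × W))} {a : ι} {x : V} {y : W}
    (h : [(a, x, y)] ∈ L) : Linearizable L [Event.inv a x, Event.res a y] := by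
  refine ⟨_, h, by simp, by simp_all, by simp, by simp, ?_⟩
  intro p q id₁ id₂ y' x' hpq hp hq
  rcases p with _ | p
  · simp at hp
  · rcases q with _ | _ | q <;> simp at hq
    omega

/-- The first operation of a linearization of a successful exchange can be run alone. -/
theorem linearizable_pair_imp [DecidableEq ι] {L : Set (List (ι × V × W))}
    (hL : ∀ S ∈ L, ∀ S', S' <+: S → S' ∈ L) {a b : ι} {x x' : V} {y y' : W}
    (h : Linearizable L [Event.inv a x, Event.inv b x', Event.res a y, Event.res b y']) :
    [(a, x, y)] ∈ L ∨ [(b, x', y')] ∈ L := by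
  obtain ⟨S, hS, -, hmem, hinv, hres, -⟩ := h
  rcases S with _ | ⟨⟨i, v, w⟩, S⟩
  · simpa using hmem a x y (by simp) (by simp)
  · have hp : [(i, v, w)] ∈ L := hL _ hS _ (by simp)
    have h₁ := hinv (i, v, w) (by simp)
    simp only [List.mem_cons, Event.inv.injEq, reduceCtorEq, List.not_mem_nil, or_false] at h₁
    rcases h₁ with ⟨rfl, rfl⟩ | ⟨rfl, rfl⟩
    · have h₂ : w = y := hres (i, v, w) (by simp) y (by simp)
      exact Or.inl (h₂ ▸ hp)
    · have h₂ : w = y' := hres (i, v, w) (by simp) y' (by simp)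
      exact Or.inr (h₂ ▸ hp)

/-- For a set `Procs` of at least two process identifiers, there is no single-operation
sequential object `L` (a prefix-closed set of sequential executions of one operation
taking an identifier as input and returning an identifier or `⊥`) such that the set of
well-formed executions linearizable with respect to `L` equals `VE(T_exc)`, the set of
well-formed executions satisfying the exchanger task. -/
theorem exchanger_has_no_single_operation_sequential_spec
    {ι : Type} [DecidableEq ι] (Procs : Finset ι) (hn : 2 ≤ Procs.card) :
    ¬ ∃ L : Set (List (ι × ι × Option ι)),
        (∀ S ∈ L, ∀ S', S' <+: S → S' ∈ L) ∧
        {E : List (Event ι ι (Option ι)) | WellFormed E ∧ Linearizable L E} =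
          {E : List (Event ι ι (Option ι)) | WellFormed E ∧ SatExc Procs E} := by
  rintro ⟨L, hL, hE⟩
  obtain ⟨a, ha, b, hb, hab⟩ := Finset.one_lt_card.mp hn
  have solo : ∀ {c d : ι}, c ≠ d → [(c, c, some d)] ∉ L := fun {c d} hcd h =>
    not_satExc_solo hcd (hE.subset ⟨wellFormed_solo c c (some d), linearizable_solo h⟩).2
  have pair := (hE.superset ⟨wellFormed_pair hab a b (some b) (some a), satExc_pair ha hb hab⟩).2
  exact (linearizable_pair_imp hL pair).elim (solo hab) (solo hab.symm)
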